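/- arXiv:2311.03845 — 3 statements merged into one kernel-verified Lean document; each statement's English description precedes it below -/
import Mathlib

section
/- Let S ⊆ ℤ[X] be a finite set of polynomials, let a ∈ ℤ with a ∉ I(S), let l ≥ 2, and let M be an l×l matrix over ℤ[X] all of whose entries lie in S. Then the integer matrix M(a) obtained by evaluating every entry of M at a is a forbidden minor for S(a) = {s.eval a : s ∈ S} if and only if M is a forbidden minor for S. -/
open Polynomial Matrix

/-- `M` is totally `S`-modular: every `k × k` subdeterminant (taken along strictly
monotone row/column selections) lies in `S`, for all `1 ≤ k ≤ min m n`. -/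
def IsTotallySModular {R : Type*} [CommRing R] {m n : ℕ}
    (S : Set R) (M : Matrix (Fin m) (Fin n) R) : Prop :=
  ∀ k : ℕ, 1 ≤ k → k ≤ min m n →
    ∀ f : Fin k → Fin m, ∀ g : Fin k → Fin n, StrictMono f → StrictMono g →
      (M.submatrix f g).det ∈ S

/-- An `l × l` matrix (`l ≥ 2`) is a forbidden minor for `S` if every
`(l-1) × (l-1)` submatrix is totally `S`-modular but its determinant is not in `S`. -/
def IsForbiddenMinor {R : Type*} [CommRing R] {l : ℕ}
    (S : Set R) (M : Matrix (Fin l) (Fin l) R) : Prop :=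
  2 ≤ l ∧
  (∀ f : Fin (l - 1) → Fin l, ∀ g : Fin (l - 1) → Fin l,
      StrictMono f → StrictMono g → IsTotallySModular S (M.submatrix f g)) ∧
  M.det ∉ S

/-- The set of determinants of forbidden minors for `S` of all sizes. -/
def FSet (S : Set (Polynomial ℤ)) : Set (Polynomial ℤ) :=
  {p | ∃ l : ℕ, ∃ M : Matrix (Fin l) (Fin l) (Polynomial ℤ),
        IsForbiddenMinor S M ∧ M.det = p}

/-- Integer points where a polynomial in `S` and a polynomial in `F(S)` agree. -/
def ISet (S : Set (Polynomial ℤ)) : Set ℤ :=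
  {a | ∃ s ∈ S, ∃ f ∈ FSet S, s.eval a = f.eval a}

/-- Evaluating the entries of a matrix commutes with taking a subdeterminant. -/
theorem det_submatrix_eval {m n k : ℕ} (M : Matrix (Fin m) (Fin n) (Polynomial ℤ)) (a : ℤ)
    (f : Fin k → Fin m) (g : Fin k → Fin n) :
    ((Matrix.of fun i j => (M i j).eval a).submatrix f g).det
      = ((M.submatrix f g).det).eval a :=
  ((Polynomial.evalRingHom a).map_det (M.submatrix f g)).symm

theorem IsTotallySModular.eval {S : Set (Polynomial ℤ)} {m n : ℕ}
    {M : Matrix (Fin m) (Fin n) (Polynomial ℤ)} (h : IsTotallySModular S M) (a : ℤ) :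
    IsTotallySModular ((fun s : Polynomial ℤ => s.eval a) '' S)
      (Matrix.of fun i j => (M i j).eval a) := by
  intro k hk hkmn f g hf hg
  exact ⟨_, h k hk hkmn f g hf hg, (det_submatrix_eval M a f g).symm⟩

/-- Outside `ISet S`, total modularity of the evaluated matrix lifts to the polynomial matrix:
a subdeterminant of minimal size outside `S` would come from a forbidden minor. -/
theorem IsTotallySModular.of_eval {S : Set (Polynomial ℤ)} {a : ℤ} (ha : a ∉ ISet S) {m n : ℕ}
    {M : Matrix (Fin m) (Fin n) (Polynomial ℤ)} (hentries : ∀ i j, M i j ∈ S)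
    (h : IsTotallySModular ((fun s : Polynomial ℤ => s.eval a) '' S)
      (Matrix.of fun i j => (M i j).eval a)) :
    IsTotallySModular S M := by
  intro k
  induction k using Nat.strong_induction_on with
  | _ k ih =>
    intro hk hkmn f g hf hg
    obtain rfl | hk2 := hk.eq_or_lt
    · simpa using hentries (f 0) (g 0)
    · by_contra hdet
      obtain ⟨s, hs, hsa⟩ := h k hk hkmn f g hf hg
      refine ha ⟨s, hs, _, ⟨k, M.submatrix f g, ⟨hk2, ?_, hdet⟩, rfl⟩,
        hsa.trans (det_submatrix_eval M a f g)⟩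
      intro f' g' hf' hg' j hj hjk f'' g'' hf'' hg''
      exact ih j (by omega) hj (by omega) (f ∘ f' ∘ f'') (g ∘ g' ∘ g'')
        (hf.comp (hf'.comp hf'')) (hg.comp (hg'.comp hg''))

theorem stmt7 (S : Set (Polynomial ℤ)) (hS : S.Finite)
    (a : ℤ) (ha : a ∉ ISet S)
    {l : ℕ} (hl : 2 ≤ l) (M : Matrix (Fin l) (Fin l) (Polynomial ℤ))
    (hentries : ∀ i j, M i j ∈ S) :
    IsForbiddenMinor ((fun s : Polynomial ℤ => s.eval a) '' S)
        (Matrix.of fun i j => (M i j).eval a) ↔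
      IsForbiddenMinor S M := by
  constructor
  · rintro ⟨-, hsub, hdet⟩
    refine ⟨hl, fun f g hf hg => ?_, fun h => hdet ⟨_, h, ?_⟩⟩
    · exact IsTotallySModular.of_eval ha (fun i j => hentries (f i) (g j)) (hsub f g hf hg)
    · exact (det_submatrix_eval M a id id).symm
  · intro hM
    refine ⟨hl, fun f g hf hg => (hM.2.1 f g hf hg).eval a, ?_⟩
    rintro ⟨s, hs, hsa⟩
    exact ha ⟨s, hs, _, ⟨l, M, hM, rfl⟩, hsa.trans (det_submatrix_eval M a id id)⟩
end

section
/- Let S ⊆ ℤ[X] be a finite set of polynomials. Then the set I(S) = {a ∈ ℤ : ∃ s ∈ S, ∃ f ∈ F(S), s.eval a = f.eval a} is finite. -/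
open Polynomial Matrix

/-- The determinant divides every `2 × 2` minor of the adjugate. -/
theorem Matrix.det_dvd_adjugate_minor {R n : Type*} [CommRing R] [IsDomain R] [Fintype n]
    [DecidableEq n] (M : Matrix n n R) (hM : M.det ≠ 0) {p q : n} (hpq : p ≠ q) (i j : n) :
    M.det ∣ M.adjugate p i * M.adjugate q j - M.adjugate p j * M.adjugate q i := by
  set A := M.adjugate with hA
  let N : Matrix n n R := Matrix.of fun r c => if c = p then A r i else if c = q then A r j
    else (1 : Matrix n n R) r c
  let U : Matrix n (Fin 2) R := Matrix.of fun r c =>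
    if c = 0 then A r i - (1 : Matrix n n R) r p else A r j - (1 : Matrix n n R) r q
  let V : Matrix (Fin 2) n R := Matrix.of fun r c =>
    if r = 0 then (1 : Matrix n n R) p c else (1 : Matrix n n R) q c
  have hN : N = 1 + U * V := by
    ext r c
    simp only [N, U, V, Matrix.add_apply, Matrix.mul_apply, Fin.sum_univ_two, Matrix.of_apply]
    by_cases hp : c = p
    · subst hp
      simp [Matrix.one_apply, hpq.symm]
    · by_cases hq : c = q
      · subst hq
        simp [Matrix.one_apply, hpq, hp]
      · simp [Matrix.one_apply, hp, hq, Ne.symm hp, Ne.symm hq]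
  have hdet : N.det = A p i * A q j - A p j * A q i := by
    rw [hN, Matrix.det_one_add_mul_comm, Matrix.det_fin_two]
    simp [U, V, Matrix.mul_apply, Matrix.one_apply, hpq, hpq.symm]
  have hAM (r c : n) : ∑ k, M r k * A k c = M.det * (1 : Matrix n n R) r c := by
    have h := congrFun (congrFun (Matrix.mul_adjugate M) r) c
    simpa [Matrix.mul_apply] using h
  let w : n → R := fun c => if c = p ∨ c = q then M.det else 1
  let B : Matrix n n R := Matrix.of fun r c => if c = p then (1 : Matrix n n R) r i
    else if c = q then (1 : Matrix n n R) r j else M r c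
  have hMN : M * N = Matrix.of fun r c => w c * B r c := by
    ext r c
    simp only [Matrix.mul_apply, N, w, B, Matrix.of_apply]
    by_cases hp : c = p
    · simp [hp, hAM]
    · by_cases hq : c = q
      · simp [hq, hAM, hpq.symm]
      · simp [hp, hq, Matrix.one_apply]
  have hw : ∏ c, w c = M.det * M.det := by
    have hfilter : Finset.univ.filter (fun c => c = p ∨ c = q) = {p, q} := by
      ext c; simp
    simp only [w]
    rw [← Finset.prod_filter, hfilter, Finset.prod_pair hpq]
  have h : M.det * N.det = M.det * (M.det * B.det) := by
    rw [← Matrix.det_mul, hMN, Matrix.det_mul_row, hw, mul_assoc]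
  exact ⟨B.det, by rw [← hdet]; exact mul_left_cancel₀ hM h⟩

/-- Two distinct rows of the adjugate of a nonsingular matrix have a nonzero `2 × 2` minor. -/
theorem Matrix.exists_adjugate_minor_ne_zero {R n : Type*} [CommRing R] [IsDomain R] [Fintype n]
    [DecidableEq n] (M : Matrix n n R) (hM : M.det ≠ 0) {p q : n} (hpq : p ≠ q) :
    ∃ i j, M.adjugate p i * M.adjugate q j - M.adjugate p j * M.adjugate q i ≠ 0 := by
  by_contra! h
  have hAM (r c : n) : ∑ k, M.adjugate r k * M k c = M.det * (1 : Matrix n n R) r c := by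
    have h := congrFun (congrFun (Matrix.adjugate_mul M) r) c
    simpa [Matrix.mul_apply] using h
  have hq (j : n) : M.adjugate q j = 0 := by
    have hsum : ∑ i, (M.adjugate p i * M.adjugate q j - M.adjugate p j * M.adjugate q i) * M i p
        = M.adjugate q j * (∑ i, M.adjugate p i * M i p)
          - M.adjugate p j * ∑ i, M.adjugate q i * M i p := by
      rw [Finset.mul_sum, Finset.mul_sum, ← Finset.sum_sub_distrib]
      exact Finset.sum_congr rfl fun i _ => by ring
    simpa [h, hAM, Matrix.one_apply, hpq.symm, hM] using hsum.symm
  exact hM (by simpa [hq] using (hAM q q).symm)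

instance Polynomial.finite_units_int : Finite ℤ[X]ˣ := by
  refine Finite.of_surjective (Units.map (C : ℤ →+* ℤ[X]).toMonoidHom) fun u => ?_
  obtain ⟨r, hr, hru⟩ := Polynomial.isUnit_iff.mp u.isUnit
  exact ⟨hr.unit, Units.ext (by simpa using hru)⟩

theorem Polynomial.finite_setOf_dvd_int {x : ℤ[X]} (hx : x ≠ 0) : {d : ℤ[X] | d ∣ x}.Finite := by
  have := Fintype.ofFinite ℤ[X]ˣ
  have := UniqueFactorizationMonoid.fintypeSubtypeDvd x hx
  exact Set.finite_coe_iff.mp (Finite.of_fintype {y : ℤ[X] // y ∣ x})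

/-- Up to sign, the entries of the adjugate of a forbidden minor lie in `S`. -/
theorem IsForbiddenMinor.adjugate_mem {R : Type*} [CommRing R] {S : Set R} {n : ℕ}
    {M : Matrix (Fin (n + 1)) (Fin (n + 1)) R} (hM : IsForbiddenMinor S M) (i j : Fin (n + 1)) :
    M.adjugate i j ∈ S ∪ Set.image Neg.neg S := by
  have hn : 1 ≤ n := by have := hM.1; omega
  have hmem : (M.submatrix j.succAbove i.succAbove).det ∈ S :=
    hM.2.1 _ _ j.strictMono_succAbove i.strictMono_succAbove n hn (by simp) id id
      strictMono_id strictMono_id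
  rw [Matrix.adjugate_fin_succ_eq_det_submatrix]
  rcases neg_one_pow_eq_or R ((j : ℕ) + i) with h | h
  · left; simpa [h] using hmem
  · right; exact ⟨_, hmem, by rw [h]; ring⟩

theorem FSet_finite {S : Set ℤ[X]} (hS : S.Finite) : (FSet S).Finite := by
  set T : Set ℤ[X] := S ∪ Set.image Neg.neg S
  have hT : T.Finite := hS.union (hS.image _)
  let D : Set ℤ[X] := Set.image2 (fun x y => x - y) (Set.image2 (fun x y => x * y) T T)
    (Set.image2 (fun x y => x * y) T T)
  have hD : D.Finite := (hT.image2 _ hT).image2 _ (hT.image2 _ hT)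
  have hfin : (insert 0 (⋃ x ∈ D \ {0}, {d : ℤ[X] | d ∣ x})).Finite :=
    ((hD.subset Set.sdiff_subset).biUnion fun x hx =>
      Polynomial.finite_setOf_dvd_int hx.2).insert 0
  refine hfin.subset ?_
  rintro _ ⟨l, M, hM, rfl⟩
  obtain ⟨n, rfl⟩ : ∃ n, l = n + 1 + 1 := ⟨l - 2, by have := hM.1; omega⟩
  by_cases hdet : M.det = 0
  · exact Or.inl hdet
  · have h01 : (0 : Fin (n + 1 + 1)) ≠ 1 := by simp
    obtain ⟨i, j, hij⟩ := M.exists_adjugate_minor_ne_zero hdet h01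
    refine Or.inr (Set.mem_biUnion ⟨?_, hij⟩ (M.det_dvd_adjugate_minor hdet h01 i j))
    exact Set.mem_image2_of_mem (Set.mem_image2_of_mem (hM.adjugate_mem _ _) (hM.adjugate_mem _ _))
      (Set.mem_image2_of_mem (hM.adjugate_mem _ _) (hM.adjugate_mem _ _))

theorem stmt8 (S : Set (Polynomial ℤ)) (hS : S.Finite) :
    Set.Finite (ISet S) := by
  have hfin : (⋃ s ∈ S, ⋃ f ∈ FSet S, {a : ℤ | s.eval a = f.eval a}).Finite := by
    refine hS.biUnion fun s hs => (FSet_finite hS).biUnion fun f hf => ?_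
    have hne : s - f ≠ 0 := by
      obtain ⟨l, M, hM, rfl⟩ := hf
      exact fun h => hM.2.2 (sub_eq_zero.mp h ▸ hs)
    refine (Polynomial.finite_setOfPred_isRoot hne).subset fun a ha => ?_
    simpa [Polynomial.IsRoot, sub_eq_zero] using ha
  refine hfin.subset ?_
  rintro a ⟨s, hs, f, hf, h⟩
  exact Set.mem_biUnion hs (Set.mem_biUnion hf h)
end

section
/- Let a ∈ ℤ with a ∉ {−3, −2, 1, 2} and let S(a) = {0, 1, −1, a, −a, a+1, −(a+1), 2*a+1, −(2*a+1)} ⊆ ℤ. An m×n integer matrix M is totally S(a)-modular if and only if there exist an m×n integer matrix T and integer vectors u ∈ ℤ^m, v ∈ ℤ^n such that M i j = T i j + a * u i * v j for all i, j, and both T and T − u ⬝ vᵀ are totally unimodular, where u ⬝ vᵀ is the m×n integer matrix with (i,j) entry u i * v j. -/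
open Polynomial Matrix

namespace IsTotallySModular

/-- For a symmetric set containing `0` and `1`, total modularity controls the minors along
arbitrary row and column selections. -/
theorem det_submatrix_mem {R : Type*} [CommRing R] {m n : ℕ} {S : Set R}
    {M : Matrix (Fin m) (Fin n) R} (hM : IsTotallySModular S M) (h0 : (0 : R) ∈ S)
    (h1 : (1 : R) ∈ S) (hneg : ∀ x ∈ S, -x ∈ S) {k : ℕ} (f : Fin k → Fin m)
    (g : Fin k → Fin n) : (M.submatrix f g).det ∈ S := by
  have hsign : ∀ (σ : Equiv.Perm (Fin k)) (x : R),
      ((Equiv.Perm.sign σ : ℤ) : R) * x ∈ S → x ∈ S := by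
    intro σ x hx
    rcases Int.units_eq_one_or (Equiv.Perm.sign σ) with h | h
    · simpa [h] using hx
    · simpa [h] using hneg _ hx
  rcases Nat.eq_zero_or_pos k with rfl | hk
  · simpa using h1
  by_cases hf : Function.Injective f
  · by_cases hg : Function.Injective g
    · have hkm : k ≤ m := by simpa using Fintype.card_le_of_injective f hf
      have hkn : k ≤ n := by simpa using Fintype.card_le_of_injective g hg
      have hmem := hM k hk (le_min hkm hkn) (f ∘ Tuple.sort f) (g ∘ Tuple.sort g)
        ((Tuple.monotone_sort f).strictMono_of_injective
          (hf.comp (Tuple.sort f).injective))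
        ((Tuple.monotone_sort g).strictMono_of_injective
          (hg.comp (Tuple.sort g).injective))
      have hsub : M.submatrix (f ∘ Tuple.sort f) (g ∘ Tuple.sort g) =
          ((M.submatrix f g).submatrix (Tuple.sort f) id).submatrix id (Tuple.sort g) := rfl
      rw [hsub, det_permute', det_permute] at hmem
      exact hsign _ _ (hsign _ _ hmem)
    · obtain ⟨i, j, hij, hne⟩ := Function.not_injective_iff.mp hg
      rw [det_zero_of_column_eq hne fun r => by simp [hij]]
      exact h0
  · obtain ⟨i, j, hij, hne⟩ := Function.not_injective_iff.mp hf
    rw [det_zero_of_row_eq hne (by ext r; simp [hij])]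
    exact h0

end IsTotallySModular

theorem Int.mem_neg_one_zero_one_iff_abs_le_one (x : ℤ) :
    x ∈ ({-1, 0, 1} : Set ℤ) ↔ |x| ≤ 1 := by
  simp only [Set.mem_insert_iff, Set.mem_singleton_iff, abs_le]
  omega

theorem isTotallySModular_neg_one_zero_one_iff {m n : ℕ} (M : Matrix (Fin m) (Fin n) ℤ) :
    IsTotallySModular ({-1, 0, 1} : Set ℤ) M ↔
      ∀ (k : ℕ) (f : Fin k → Fin m) (g : Fin k → Fin n), |(M.submatrix f g).det| ≤ 1 := by
  constructor
  · intro h k f g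
    rw [← Int.mem_neg_one_zero_one_iff_abs_le_one]
    refine h.det_submatrix_mem (by simp) (by simp) (fun x hx => ?_) f g
    rw [Int.mem_neg_one_zero_one_iff_abs_le_one] at hx ⊢
    rwa [abs_neg]
  · intro h k _ _ f g _ _
    exact (Int.mem_neg_one_zero_one_iff_abs_le_one _).mpr (h k f g)

/-- The elements of `S(a)` are the integers `(a + 1) c - a d` with `c, d ∈ {-1, 0, 1}`. -/
theorem mem_modular_set_iff (a x : ℤ) :
    x ∈ ({0, 1, -1, a, -a, a + 1, -(a + 1), 2 * a + 1, -(2 * a + 1)} : Set ℤ) ↔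
      ∃ c d : ℤ, |c| ≤ 1 ∧ |d| ≤ 1 ∧ x = (a + 1) * c - a * d := by
  simp only [Set.mem_insert_iff, Set.mem_singleton_iff]
  constructor
  · rintro (h | h | h | h | h | h | h | h | h)
    · exact ⟨0, 0, by simp, by simp, by rw [h]; ring⟩
    · exact ⟨1, 1, by simp, by simp, by rw [h]; ring⟩
    · exact ⟨-1, -1, by simp, by simp, by rw [h]; ring⟩
    · exact ⟨0, -1, by simp, by simp, by rw [h]; ring⟩
    · exact ⟨0, 1, by simp, by simp, by rw [h]; ring⟩
    · exact ⟨1, 0, by simp, by simp, by rw [h]; ring⟩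
    · exact ⟨-1, 0, by simp, by simp, by rw [h]; ring⟩
    · exact ⟨1, -1, by simp, by simp, by rw [h]; ring⟩
    · exact ⟨-1, 1, by simp, by simp, by rw [h]; ring⟩
  · rintro ⟨c, d, hc, hd, rfl⟩
    rw [abs_le] at hc hd
    obtain ⟨hc₁, hc₂⟩ := hc
    obtain ⟨hd₁, hd₂⟩ := hd
    interval_cases c <;> interval_cases d <;> omega

theorem IsTotallySModular.exists_det_submatrix_eq {a : ℤ} {m n : ℕ}
    {M : Matrix (Fin m) (Fin n) ℤ}
    (hM : IsTotallySModular
      ({0, 1, -1, a, -a, a + 1, -(a + 1), 2 * a + 1, -(2 * a + 1)} : Set ℤ) M)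
    {k : ℕ} (f : Fin k → Fin m) (g : Fin k → Fin n) :
    ∃ c d : ℤ, |c| ≤ 1 ∧ |d| ≤ 1 ∧ (M.submatrix f g).det = (a + 1) * c - a * d := by
  rw [← mem_modular_set_iff]
  refine hM.det_submatrix_mem (by simp) (by simp) (fun x hx => ?_) f g
  rw [mem_modular_set_iff] at hx ⊢
  obtain ⟨c, d, hc, hd, rfl⟩ := hx
  exact ⟨-c, -d, by rwa [abs_neg], by rwa [abs_neg], by ring⟩

/-- The determinant is affine along a rank-one direction. -/
theorem Matrix.det_add_smul_vecMulVec {R ι : Type*} [CommRing R] [Fintype ι] [DecidableEq ι]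
    (A : Matrix ι ι R) (u v : ι → R) (x : R) :
    (A + x • vecMulVec u v).det = (x + 1) * A.det - x * (A - vecMulVec u v).det := by
  let N : Matrix (ι ⊕ Unit) (ι ⊕ Unit) R := fromBlocks A 0 (replicateRow Unit v) 1
  have key : ∀ y : R, (A + y • vecMulVec u v).det =
      y * (N.updateCol (Sum.inr ()) (Sum.elim (-u) (0 : Unit → R))).det +
        (N.updateCol (Sum.inr ()) (Sum.elim (0 : ι → R) (1 : Unit → R))).det := by
    intro y
    rw [← det_updateCol_smul, ← det_updateCol_add]
    have hN : N.updateCol (Sum.inr ()) 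
          (y • Sum.elim (-u) (0 : Unit → R) + Sum.elim (0 : ι → R) (1 : Unit → R)) =
        fromBlocks A (replicateCol Unit (-(y • u))) (replicateRow Unit v) 1 := by
      ext i j
      rcases i with i | i <;> rcases j with j | j <;> simp [N]
    rw [hN, det_fromBlocks_one₂₂]
    congr 1
    ext i j
    simp [mul_apply, vecMulVec_apply, mul_assoc]
  have h0 := key 0
  have h1 := key (-1)
  simp only [zero_smul, add_zero, zero_mul, zero_add, neg_smul, one_smul,
    ← sub_eq_add_neg] at h0 h1
  rw [key x, h0, h1]
  ring

/-- Pivoting on a unit entry in the top left corner. -/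
theorem Matrix.det_schur_complement_corner {R : Type*} [CommRing R] {k : ℕ}
    (C : Matrix (Fin (k + 1)) (Fin (k + 1)) R) (hp : C 0 0 * C 0 0 = 1) :
    (Matrix.of fun i j : Fin k =>
      C i.succ j.succ - C 0 0 * C i.succ 0 * C 0 j.succ).det = C 0 0 * C.det := by
  let t : Fin (k + 1) → R := Fin.cons 0 fun r : Fin k => -(C 0 0 * C r.succ 0)
  let B : Matrix (Fin (k + 1)) (Fin (k + 1)) R := Matrix.of fun i j => C i j + t i * C 0 j
  have hB : B.det = C.det :=
    det_eq_of_forall_row_eq_smul_add_const t 0 rfl fun i j => rfl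
  have hcol : ∀ i : Fin k, B i.succ 0 = 0 := by
    intro i
    simp only [B, t, of_apply, Fin.cons_succ]
    linear_combination (-C i.succ 0) * hp
  have hsub : B.submatrix Fin.succ Fin.succ = Matrix.of fun i j : Fin k =>
      C i.succ j.succ - C 0 0 * C i.succ 0 * C 0 j.succ := by
    ext i j
    simp only [B, t, submatrix_apply, of_apply, Fin.cons_succ]
    ring
  rw [← hB, det_succ_column_zero B, Fin.sum_univ_succ]
  simp only [hcol, Fin.succAbove_zero, hsub]
  have h00 : B 0 0 = C 0 0 := by simp [B, t]
  simp [h00, ← mul_assoc, hp]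

theorem Int.mul_self_eq_one_of_abs_le_one {x : ℤ} (hx : |x| ≤ 1) (h0 : x ≠ 0) : x * x = 1 := by
  rw [abs_le] at hx
  obtain rfl | rfl : x = 1 ∨ x = -1 := by omega
  all_goals norm_num

/-- An integer matrix of size at least two whose proper minors all lie in `{-1, 0, 1}` has
determinant at most two in absolute value. -/
theorem Matrix.abs_det_le_two_of_proper_minors (k : ℕ)
    (A : Matrix (Fin (k + 2)) (Fin (k + 2)) ℤ)
    (hA : ∀ j < k + 2, ∀ f g : Fin j → Fin (k + 2), |(A.submatrix f g).det| ≤ 1) :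
    |A.det| ≤ 2 := by
  have entry : ∀ {l : ℕ} (B : Matrix (Fin (l + 2)) (Fin (l + 2)) ℤ),
      (∀ j < l + 2, ∀ f g : Fin j → Fin (l + 2), |(B.submatrix f g).det| ≤ 1) →
      ∀ i j, |B i j| ≤ 1 := by
    intro l B hB i j
    simpa using hB 1 (by omega) (fun _ => i) (fun _ => j)
  induction k with
  | zero =>
    have h := entry A hA
    rw [det_fin_two]
    have h₁ : |A 0 0 * A 1 1| ≤ 1 := by
      rw [abs_mul]
      exact mul_le_one₀ (h 0 0) (abs_nonneg _) (h 1 1)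
    have h₂ : |A 0 1 * A 1 0| ≤ 1 := by
      rw [abs_mul]
      exact mul_le_one₀ (h 0 1) (abs_nonneg _) (h 1 0)
    rw [abs_le] at *
    constructor <;> linarith [h₁.1, h₁.2, h₂.1, h₂.2]
  | succ k ih =>
    by_cases hcol : ∀ i, A i 0 = 0
    · rw [det_eq_zero_of_column_eq_zero 0 hcol]
      norm_num
    push Not at hcol
    obtain ⟨i, hi⟩ := hcol
    let σ : Equiv.Perm (Fin (k + 1 + 2)) := Equiv.swap 0 i
    let C := A.submatrix σ id
    have hCA : |C.det| = |A.det| := by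
      rw [det_permute, abs_mul]
      rcases Int.units_eq_one_or (Equiv.Perm.sign σ) with h | h <;> simp [h]
    have hC : ∀ j < k + 1 + 2, ∀ f g : Fin j → Fin (k + 1 + 2),
        |(C.submatrix f g).det| ≤ 1 := fun j hj f g => hA j hj (σ ∘ f) g
    have hC0 : C 0 0 ≠ 0 := by simpa [C, σ] using hi
    have hp := Int.mul_self_eq_one_of_abs_le_one (entry C hC 0 0) hC0
    have habs : |C 0 0| = 1 := Int.isUnit_iff_abs_eq.mp (.of_mul_eq_one _ hp)
    let B : Matrix (Fin (k + 2)) (Fin (k + 2)) ℤ :=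
      Matrix.of fun i j => C i.succ j.succ - C 0 0 * C i.succ 0 * C 0 j.succ
    have hB : |B.det| ≤ 2 := by
      refine ih B fun j hj f g => ?_
      let D := C.submatrix (Fin.cons 0 (Fin.succ ∘ f) : Fin (j + 1) → _)
        (Fin.cons 0 (Fin.succ ∘ g) : Fin (j + 1) → _)
      have hdet : (B.submatrix f g).det = C 0 0 * D.det := det_schur_complement_corner D hp
      rw [hdet, abs_mul, habs, one_mul]
      exact hC _ (by omega) _ _
    rw [det_schur_complement_corner C hp, abs_mul, habs, one_mul, hCA] at hB
    exact hB

/-- To bound all minors by one it suffices to exclude minors equal to `±2`. -/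
theorem Matrix.abs_det_submatrix_le_one_of_step {m n : ℕ} (T : Matrix (Fin m) (Fin n) ℤ)
    (hentry : ∀ i j, |T i j| ≤ 1)
    (hstep : ∀ (k : ℕ) (f : Fin k → Fin m) (g : Fin k → Fin n),
      |(T.submatrix f g).det| ≤ 2 → |(T.submatrix f g).det| ≤ 1)
    (k : ℕ) (f : Fin k → Fin m) (g : Fin k → Fin n) : |(T.submatrix f g).det| ≤ 1 := by
  induction k using Nat.strong_induction_on with
  | _ k ih =>
    match k, f, g, ih with
    | 0, _, _, _ => simp
    | 1, f, g, _ => simpa using hentry (f 0) (g 0)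
    | k + 2, f, g, ih =>
      exact hstep _ f g (abs_det_le_two_of_proper_minors k _
        fun j hj f' g' => ih j hj (f ∘ f') (g ∘ g'))

theorem Matrix.dvd_det_sub_det {R ι : Type*} [CommRing R] [Fintype ι] [DecidableEq ι]
    {q : R} {A B : Matrix ι ι R} (h : ∀ i j, q ∣ A i j - B i j) : q ∣ A.det - B.det := by
  rw [← Ideal.mem_span_singleton, ← Ideal.Quotient.eq, RingHom.map_det, RingHom.map_det]
  congr 1
  ext i j
  exact Ideal.Quotient.eq.mpr (Ideal.mem_span_singleton.mpr (h i j))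

/-- Over a principal ideal domain, a matrix with vanishing `2 × 2` minors is an outer product. -/
theorem Matrix.exists_eq_vecMulVec_of_minors_eq_zero {R m n : Type*} [CommRing R] [IsDomain R]
    [IsPrincipalIdealRing R] [Fintype n] (E : Matrix m n R)
    (hE : ∀ i i' j j', E i j * E i' j' = E i j' * E i' j) :
    ∃ (u : m → R) (v : n → R), E = vecMulVec u v := by
  by_cases h0 : E = 0
  · exact ⟨0, 0, by simp [h0]⟩
  obtain ⟨i₀, j₀, hne⟩ : ∃ i j, E i j ≠ 0 := by
    by_contra! h
    exact h0 (by ext i j; exact h i j)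
  let I : Ideal R := Ideal.span (Set.range (E i₀))
  let g : R := Submodule.IsPrincipal.generator I
  have hmem : ∀ j, ∃ w, E i₀ j = w * g := by
    intro j
    obtain ⟨w, hw⟩ := (Submodule.IsPrincipal.mem_iff_eq_smul_generator I).mp
      (Ideal.subset_span (Set.mem_range_self j))
    exact ⟨w, hw⟩
  choose v hv using hmem
  have hg : g ≠ 0 := fun h => hne (by rw [hv, h, mul_zero])
  obtain ⟨b, hb⟩ := Ideal.mem_span_range_iff_exists_fun.mp
    (Submodule.IsPrincipal.generator_mem I)
  have hbv : ∑ j, b j * v j = 1 := by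
    apply mul_right_cancel₀ hg
    rw [Finset.sum_mul, one_mul]
    refine Eq.trans (Finset.sum_congr rfl fun j _ => ?_) hb
    rw [hv, mul_assoc]
  refine ⟨fun i => ∑ j, b j * E i j, v, ?_⟩
  ext i j'
  have hcross : ∀ j, E i j' * v j = E i j * v j' := by
    intro j
    apply mul_right_cancel₀ hg
    have := hE i i₀ j' j
    rw [hv, hv] at this
    linear_combination this
  rw [vecMulVec_apply, Finset.sum_mul]
  calc E i j' = ∑ j, b j * (E i j' * v j) := by
        simp only [mul_left_comm (b _), ← Finset.mul_sum, hbv, mul_one]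
    _ = ∑ j, b j * E i j * v j' := by
        refine Finset.sum_congr rfl fun j _ => ?_
        rw [hcross]
        ring

theorem Int.eq_of_dvd_sub_of_abs_le_one {q x y : ℤ} (hq : 3 ≤ q) (h : q ∣ x - y)
    (hx : |x| ≤ 1) (hy : |y| ≤ 1) : x = y := by
  rw [abs_le] at hx hy
  have := Int.eq_zero_of_abs_lt_dvd h (by rw [abs_lt]; omega)
  omega

theorem Int.abs_le_one_of_dvd_sub {q x y : ℤ} (hq : 4 ≤ q) (h : q ∣ x - y)
    (hx : |x| ≤ 2) (hy : |y| ≤ 1) : |x| ≤ 1 := by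
  rw [abs_le] at hx hy
  have := Int.eq_zero_of_abs_lt_dvd h (by rw [abs_lt]; omega)
  rw [abs_le]
  omega

/-- If the `2 × 2` determinant of `(a + 1) X - a Y` has the form prescribed by `S(a)`, the
determinant of `X` cannot equal `2`. -/
theorem two_by_two_det_ne_two {a : ℤ} (ha : 3 ≤ a) {x y z w x' y' z' w' c d : ℤ}
    (hx : |x| ≤ 1) (hy : |y| ≤ 1) (hz : |z| ≤ 1) (hw : |w| ≤ 1)
    (hx' : |x'| ≤ 1) (hy' : |y'| ≤ 1) (hz' : |z'| ≤ 1) (hw' : |w'| ≤ 1)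
    (hc : |c| ≤ 1) (hd : |d| ≤ 1)
    (h : ((a + 1) * x - a * x') * ((a + 1) * w - a * w') -
      ((a + 1) * y - a * y') * ((a + 1) * z - a * z') = (a + 1) * c - a * d) :
    x * w - y * z ≠ 2 := by
  intro h2
  have hmod : a ∣ 2 - c :=
    ⟨c - d - (a + 2) * (x * w - y * z) + (a + 1) * (x * w' + x' * w - y * z' - y' * z) -
      a * (x' * w' - y' * z'), by linear_combination h - h2⟩
  have hpos : ∀ p q p' q' : ℤ, |p'| ≤ 1 → |q'| ≤ 1 → p * q = 1 →
      1 ≤ ((a + 1) * p - a * p') * ((a + 1) * q - a * q') := by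
    intro p q p' q' hp' hq' hpq
    rw [abs_le] at hp' hq'
    rcases Int.mul_eq_one_iff_eq_one_or_neg_one.mp hpq with ⟨rfl, rfl⟩ | ⟨rfl, rfl⟩
    · have h₁ : 1 ≤ (a + 1) * 1 - a * p' := by nlinarith
      have h₂ : 1 ≤ (a + 1) * 1 - a * q' := by nlinarith
      nlinarith
    · have h₁ : 1 ≤ (a + 1) * 1 + a * p' := by nlinarith
      have h₂ : 1 ≤ (a + 1) * 1 + a * q' := by nlinarith
      nlinarith
  have hxw : |x * w| ≤ 1 := by
    rw [abs_mul]
    exact mul_le_one₀ hx (abs_nonneg _) hw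
  have hyz : |y * z| ≤ 1 := by
    rw [abs_mul]
    exact mul_le_one₀ hy (abs_nonneg _) hz
  rw [abs_le] at hxw hyz hc hd
  have h₁ := hpos x w x' w' hx' hw' (by omega)
  have h₂ := hpos y (-z) y' (-z') hy' (by rwa [abs_neg]) (by rw [mul_neg]; omega)
  have hle := Int.le_of_dvd (by omega) hmod
  obtain rfl : c = -1 := by omega
  nlinarith

/-- If the `2 × 2` determinant of `(a + 1) X - a Y` has the form prescribed by `S(a)` and
`det Y` lies in `{-1, 0, 1}`, then `X - Y` is singular. -/
theorem two_by_two_det_sub_eq_zero {a : ℤ} (ha : 3 ≤ a) {x y z w x' y' z' w' c d : ℤ}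
    (hx : |x| ≤ 1) (hy : |y| ≤ 1) (hz : |z| ≤ 1) (hw : |w| ≤ 1)
    (hx' : |x'| ≤ 1) (hy' : |y'| ≤ 1) (hz' : |z'| ≤ 1) (hw' : |w'| ≤ 1)
    (hc : |c| ≤ 1) (hd : |d| ≤ 1) (hdet' : |x' * w' - y' * z'| ≤ 1)
    (h : ((a + 1) * x - a * x') * ((a + 1) * w - a * w') -
      ((a + 1) * y - a * y') * ((a + 1) * z - a * z') = (a + 1) * c - a * d) :
    (x - x') * (w - w') = (y - y') * (z - z') := by
  have hdet : |x * w - y * z| ≤ 1 := by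
    have h₁ := two_by_two_det_ne_two ha hx hy hz hw hx' hy' hz' hw' hc hd h
    have h₂ := two_by_two_det_ne_two ha hy hx hw hz hy' hx' hw' hz'
      (c := -c) (d := -d) (by rwa [abs_neg]) (by rwa [abs_neg]) (by linear_combination -h)
    have hxw : |x * w| ≤ 1 := by
      rw [abs_mul]
      exact mul_le_one₀ hx (abs_nonneg _) hw
    have hyz : |y * z| ≤ 1 := by
      rw [abs_mul]
      exact mul_le_one₀ hy (abs_nonneg _) hz
    rw [abs_le] at *
    omega
  set e := (x - x') * (w - w') - (y - y') * (z - z') with he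
  have hform : (a + 1) * (x * w - y * z) - a * (x' * w' - y' * z') + e * (a * (a + 1)) =
      (a + 1) * c - a * d := by
    rw [← h, he]
    ring
  have h₁ : x * w - y * z = c := Int.eq_of_dvd_sub_of_abs_le_one ha
    ⟨(x' * w' - y' * z') - d - (x * w - y * z) + c - e * (a + 1),
      by linear_combination hform⟩ hdet hc
  have h₂ : x' * w' - y' * z' = d := Int.eq_of_dvd_sub_of_abs_le_one (q := a + 1) (by omega)
    ⟨(x' * w' - y' * z') - d - (x * w - y * z) + c - e * a,
      by linear_combination hform⟩ hdet' hd
  rw [h₁, h₂, add_eq_left] at hform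
  have hpos : a * (a + 1) ≠ 0 := by positivity
  have := (mul_eq_zero.mp hform).resolve_right hpos
  linarith

/-- For `a ≥ 3`, a totally `S(a)`-modular matrix interpolates two totally unimodular matrices
that differ by an outer product. -/
theorem exists_unimodular_pair {a : ℤ} (ha : 3 ≤ a) {m n : ℕ} {M : Matrix (Fin m) (Fin n) ℤ}
    (hM : IsTotallySModular
      ({0, 1, -1, a, -a, a + 1, -(a + 1), 2 * a + 1, -(2 * a + 1)} : Set ℤ) M) :
    ∃ (T : Matrix (Fin m) (Fin n) ℤ) (u : Fin m → ℤ) (v : Fin n → ℤ),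
      M = T + a • vecMulVec u v ∧
      IsTotallySModular ({-1, 0, 1} : Set ℤ) T ∧
      IsTotallySModular ({-1, 0, 1} : Set ℤ) (T - vecMulVec u v) := by
  have hentry : ∀ i j, ∃ c d : ℤ, |c| ≤ 1 ∧ |d| ≤ 1 ∧ M i j = (a + 1) * c - a * d := by
    intro i j
    simpa using hM.exists_det_submatrix_eq (fun _ : Fin 1 => i) (fun _ : Fin 1 => j)
  choose T T' hT hT' hMT using hentry
  have hmod : ∀ i j, a + 1 ∣ T' i j - M i j := fun i j =>
    ⟨T' i j - T i j, by rw [hMT]; ring⟩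
  have hTU' : ∀ (k : ℕ) (f : Fin k → Fin m) (g : Fin k → Fin n),
      |((Matrix.of T').submatrix f g).det| ≤ 1 := by
    refine abs_det_submatrix_le_one_of_step _ hT' fun k f g h => ?_
    obtain ⟨c, d, hc, hd, hcd⟩ := hM.exists_det_submatrix_eq f g
    refine Int.abs_le_one_of_dvd_sub (q := a + 1) (by omega) ?_ h hd
    have hdvd : a + 1 ∣ ((Matrix.of T').submatrix f g).det - (M.submatrix f g).det :=
      dvd_det_sub_det fun i j => hmod (f i) (g j)
    rw [hcd] at hdvd
    obtain ⟨r, hr⟩ := hdvd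
    exact ⟨r + c - d, by linear_combination hr⟩
  obtain ⟨u, v, huv⟩ := exists_eq_vecMulVec_of_minors_eq_zero (Matrix.of T - Matrix.of T') (by
    intro i i' j j'
    obtain ⟨c, d, hc, hd, hcd⟩ := hM.exists_det_submatrix_eq ![i, i'] ![j, j']
    have hdet' := hTU' 2 ![i, i'] ![j, j']
    simp only [det_fin_two, submatrix_apply, cons_val_zero, cons_val_one, of_apply,
      hMT] at hcd hdet'
    exact two_by_two_det_sub_eq_zero ha (hT _ _) (hT _ _) (hT _ _) (hT _ _)
      (hT' _ _) (hT' _ _) (hT' _ _) (hT' _ _) hc hd hdet' hcd)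
  have hT'eq : Matrix.of T' = Matrix.of T - vecMulVec u v := by rw [← huv, sub_sub_cancel]
  have hMeq : M = Matrix.of T + a • vecMulVec u v := by
    rw [← huv]
    ext i j
    simp only [hMT, Matrix.add_apply, Matrix.smul_apply, Matrix.sub_apply, of_apply,
      smul_eq_mul]
    ring
  refine ⟨Matrix.of T, u, v, hMeq, ?_, ?_⟩
  · rw [isTotallySModular_neg_one_zero_one_iff]
    intro k f g
    obtain ⟨c, d, hc, hd, hcd⟩ := hM.exists_det_submatrix_eq f g
    have hd' := hTU' k f g
    have hdet := det_add_smul_vecMulVec ((Matrix.of T).submatrix f g) (u ∘ f) (v ∘ g) a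
    rw [hT'eq] at hd'
    rw [hMeq] at hcd
    change det ((Matrix.of T + a • vecMulVec u v).submatrix f g) = (a + 1) *
      ((Matrix.of T).submatrix f g).det -
      a * ((Matrix.of T - vecMulVec u v).submatrix f g).det at hdet
    rw [hcd] at hdet
    generalize ((Matrix.of T).submatrix f g).det = p at *
    generalize ((Matrix.of T - vecMulVec u v).submatrix f g).det = q at *
    have hdvd : a + 1 ∣ q - d := ⟨q - d - (p - c), by linear_combination -hdet⟩
    have hqd := Int.eq_of_dvd_sub_of_abs_le_one (by omega) hdvd hd' hd
    have hpc : (a + 1) * (p - c) = 0 := by rw [hqd] at hdet; linear_combination -hdet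
    have : p = c := by
      have := (mul_eq_zero.mp hpc).resolve_left (by omega)
      omega
    rwa [this]
  · rw [isTotallySModular_neg_one_zero_one_iff, ← hT'eq]
    exact hTU'

theorem isTotallySModular_of_unimodular_pair (a : ℤ) {m n : ℕ} {T : Matrix (Fin m) (Fin n) ℤ}
    {u : Fin m → ℤ} {v : Fin n → ℤ} (hT : IsTotallySModular ({-1, 0, 1} : Set ℤ) T)
    (hT' : IsTotallySModular ({-1, 0, 1} : Set ℤ) (T - vecMulVec u v)) :
    IsTotallySModular
      ({0, 1, -1, a, -a, a + 1, -(a + 1), 2 * a + 1, -(2 * a + 1)} : Set ℤ)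
      (T + a • vecMulVec u v) := by
  rw [isTotallySModular_neg_one_zero_one_iff] at hT hT'
  intro k _ _ f g _ _
  rw [mem_modular_set_iff]
  exact ⟨_, _, hT k f g, hT' k f g,
    det_add_smul_vecMulVec (T.submatrix f g) (u ∘ f) (v ∘ g) a⟩

theorem stmt15 (a : ℤ) (ha : a ∉ ({-3, -2, 1, 2} : Set ℤ))
    {m n : ℕ} (M : Matrix (Fin m) (Fin n) ℤ) :
    IsTotallySModular
        ({0, 1, -1, a, -a, a + 1, -(a + 1), 2 * a + 1, -(2 * a + 1)} : Set ℤ) M ↔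
      ∃ T : Matrix (Fin m) (Fin n) ℤ, ∃ u : Fin m → ℤ, ∃ v : Fin n → ℤ,
        (∀ i j, M i j = T i j + a * (u i * v j)) ∧
        IsTotallySModular ({-1, 0, 1} : Set ℤ) T ∧
        IsTotallySModular ({-1, 0, 1} : Set ℤ) (T - Matrix.of fun i j => u i * v j) := by
  constructor
  · intro hM
    simp only [Set.mem_insert_iff, Set.mem_singleton_iff, not_or] at ha
    obtain h | h | h : (a = 0 ∨ a = -1) ∨ 3 ≤ a ∨ 3 ≤ -1 - a := by omega
    · have hTU : IsTotallySModular ({-1, 0, 1} : Set ℤ) M := by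
        convert hM using 1
        ext x
        simp only [Set.mem_insert_iff, Set.mem_singleton_iff]
        omega
      refine ⟨M, 0, 0, by simp, hTU, ?_⟩
      convert hTU using 1
      ext i j
      simp
    · obtain ⟨T, u, v, hMT, hT, hT'⟩ := exists_unimodular_pair h hM
      exact ⟨T, u, v, fun i j => by simp [hMT, vecMulVec_apply], hT, hT'⟩
    · obtain ⟨T, u, v, hMT, hT, hT'⟩ := exists_unimodular_pair (a := -1 - a) h (M := M) (by
        convert hM using 1
        ext x
        simp only [Set.mem_insert_iff, Set.mem_singleton_iff]
        omega)
      refine ⟨T - vecMulVec u v, -u, v, fun i j => ?_, hT', ?_⟩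
      · simp only [hMT, Matrix.add_apply, Matrix.sub_apply, Matrix.smul_apply, vecMulVec_apply,
          smul_eq_mul, Pi.neg_apply]
        ring
      · convert hT using 1
        ext i j
        simp [vecMulVec_apply]
  · rintro ⟨T, u, v, hMT, hT, hT'⟩
    have hM : M = T + a • vecMulVec u v := by
      ext i j
      simp [hMT, vecMulVec_apply]
    rw [hM]
    exact isTotallySModular_of_unimodular_pair a hT hT'
end
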